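/- arXiv:1511.08948 — 4 statements merged into one kernel-verified Lean document; each statement's English description precedes it below -/
import Mathlib

section
/- Let H be a connected commutative graded k-algebra and let e_1,…,e_r be a q-regular sequence of homogeneous elements of even positive degree in H, for some q ≥ 0. Form the Hirsch extension A = H ⊗_τ Λ(t_1,…,t_r) of the CDGA (H, d = 0), where each generator t_α has odd degree deg(e_α) − 1 and d t_α = τ(t_α) = e_α. Then the CDGA morphism ψ : A → (H/Σ_α e_α H, d = 0), which restricts to the canonical projection on H and sends each t_α to 0, is a q-equivalence. In particular, A has the same q-type as (H/Σ_α e_α H, d = 0), so A is q-formal. -/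
noncomputable section
set_option synthInstance.maxHeartbeats 1000000
set_option maxHeartbeats 1600000
set_option linter.unusedVariables false

open scoped TensorProduct

universe u v

/-- A commutative differential graded algebra (CDGA) over a field `k`:
a non-negatively graded `k`-vector space with an associative unital multiplication
satisfying graded commutativity, together with a degree-one differential satisfying
`d ∘ d = 0` and the graded Leibniz rule. -/
structure CDGA (k : Type u) [Field k] where
  carrier : Type v
  [ring : Ring carrier]
  [algebra : Algebra k carrier]
  grading : ℕ → Submodule k carrier
  decomp : DirectSum.Decomposition grading
  one_mem : (1 : carrier) ∈ grading 0
  mul_mem : ∀ {i j : ℕ} {a b : carrier}, a ∈ grading i → b ∈ grading j →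
      a * b ∈ grading (i + j)
  gcomm : ∀ {i j : ℕ} {a b : carrier}, a ∈ grading i → b ∈ grading j →
      a * b = (-1 : k) ^ (i * j) • (b * a)
  d : carrier →ₗ[k] carrier
  d_mem : ∀ {i : ℕ} {a : carrier}, a ∈ grading i → d a ∈ grading (i + 1)
  d_d : ∀ a : carrier, d (d a) = 0
  leibniz : ∀ {i : ℕ} {a : carrier}, a ∈ grading i → ∀ b : carrier,
      d (a * b) = d a * b + (-1 : k) ^ i • (a * d b)

attribute [instance] CDGA.ring CDGA.algebra

namespace CDGA

variable {k : Type u} [Field k]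

/-- The `d`-cocycles of degree `i`. -/
def Zc (A : CDGA k) (i : ℕ) : Submodule k A.carrier :=
  A.grading i ⊓ LinearMap.ker A.d

/-- The `d`-coboundaries of degree `i`. -/
def Bc (A : CDGA k) : ℕ → Submodule k A.carrier
  | 0 => ⊥
  | (i + 1) => (A.grading i).map A.d

/-- A CDGA is connected if its degree-zero part is `k·1`. -/
def Connected (A : CDGA k) : Prop :=
  A.grading 0 = Submodule.span k {(1 : A.carrier)}

end CDGA

/-- A morphism of CDGAs: an algebra map preserving the grading and commuting with
the differentials. -/
structure CDGAHom {k : Type u} [Field k] (A B : CDGA k) where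
  toFun : A.carrier →ₐ[k] B.carrier
  map_grading : ∀ {i : ℕ} {a : A.carrier}, a ∈ A.grading i → toFun a ∈ B.grading i
  map_d : ∀ a : A.carrier, toFun (A.d a) = B.d (toFun a)

/-- `φ : A → B` is a `q`-equivalence if the induced map `H^i(A) → H^i(B)` is an
isomorphism for `i ≤ q` and injective for `i = q + 1`. -/
def CDGAHom.IsQEquiv {k : Type u} [Field k] {A B : CDGA k} (φ : CDGAHom A B) (q : ℕ) : Prop :=
  (∀ i ≤ q, ∀ b ∈ B.Zc i, ∃ a ∈ A.Zc i, φ.toFun a - b ∈ B.Bc i) ∧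
  (∀ i ≤ q + 1, ∀ a ∈ A.Zc i, φ.toFun a ∈ B.Bc i → a ∈ A.Bc i)

/-- The ordered square-free monomial in the generators `t` indexed by `S`. -/
def tmono {k : Type u} [Field k] (A : CDGA k) {r : ℕ} (t : Fin r → A.carrier)
    (S : Finset (Fin r)) : A.carrier :=
  ((S.sort (· ≤ ·)).map t).prod

/-- `A` is the Hirsch extension `B ⊗_τ ΛP`, where `P` has homogeneous basis
`t_1, …, t_r` of odd degrees `m_1, …, m_r`, with `d t_i = τ(t_i) = e_i`. -/
structure IsHirsch {k : Type u} [Field k] (B A : CDGA k) (φ : CDGAHom B A)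
    {r : ℕ} (m : Fin r → ℕ) (t : Fin r → A.carrier) (e : Fin r → B.carrier) : Prop where
  odd_deg : ∀ i, Odd (m i)
  t_mem : ∀ i, t i ∈ A.grading (m i)
  e_cocycle : ∀ i, e i ∈ B.Zc (m i + 1)
  dt : ∀ i, A.d (t i) = φ.toFun (e i)
  inj : Function.Injective φ.toFun
  free : ∀ a : A.carrier, ∃! c : Finset (Fin r) → B.carrier,
      a = ∑ S : Finset (Fin r), φ.toFun (c S) * tmono A t S
  mono_mem : ∀ (S : Finset (Fin r)) {j : ℕ} {b : B.carrier}, b ∈ B.grading j →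
      φ.toFun b * tmono A t S ∈ A.grading (j + ∑ i ∈ S, m i)

section Statement0

variable {k : Type u} [Field k]

/-- The submodule `Σ_{β ∈ s} e_β H` of `H`. -/
def mulIdeal (H : CDGA k) {r : ℕ} (e : Fin r → H.carrier) (s : Set (Fin r)) :
    Submodule k H.carrier :=
  ⨆ β ∈ s, LinearMap.range (LinearMap.mulLeft k (e β))

/-- A sequence `e_1, …, e_r` of homogeneous elements of degrees `n_1, …, n_r` is `q`-regular if,
for each `α`, the class of `e_α` in `H/Σ_{β<α} e_β H` is a non-zero divisor up to degree
`q - n_α + 2`. -/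
def QRegular (H : CDGA k) (q : ℕ) {r : ℕ} (n : Fin r → ℕ) (e : Fin r → H.carrier) : Prop :=
  ∀ α : Fin r, ∀ i : ℕ, (i : ℤ) ≤ (q : ℤ) - (n α : ℤ) + 2 →
    ∀ x ∈ H.grading i, e α * x ∈ mulIdeal H e {β | β < α} →
      x ∈ mulIdeal H e {β | β < α}

attribute [local instance] CDGA.decomp

namespace CDGA

/-- The grading of a CDGA extended by zero to integer degrees. -/
def zgrading (A : CDGA k) (i : ℤ) : Submodule k A.carrier :=
  if 0 ≤ i then A.grading i.toNat else ⊥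

/-- The projection of a CDGA onto its part of integer degree `i`. -/
def zproj (A : CDGA k) (i : ℤ) : A.carrier →ₗ[k] A.carrier :=
  if 0 ≤ i then
    (A.grading i.toNat).subtype ∘ₗ DirectSum.component k ℕ (fun j => A.grading j) i.toNat ∘ₗ
      (DirectSum.decomposeLinearEquiv A.grading).toLinearMap
  else 0

theorem mem_zgrading_natCast (A : CDGA k) (i : ℕ) {a : A.carrier} :
    a ∈ A.zgrading i ↔ a ∈ A.grading i := by
  simp [zgrading]

theorem mem_zgrading_iff (A : CDGA k) {i : ℤ} {a : A.carrier} :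
    a ∈ A.zgrading i ↔ a = 0 ∨ ∃ j : ℕ, (j : ℤ) = i ∧ a ∈ A.grading j := by
  constructor
  · intro h
    by_cases hi : 0 ≤ i
    · exact Or.inr ⟨i.toNat, by omega, by simpa [zgrading, hi] using h⟩
    · exact Or.inl (by simpa [zgrading, hi] using h)
  · rintro (rfl | ⟨j, rfl, h⟩)
    · exact zero_mem _
    · exact (A.mem_zgrading_natCast j).2 h

theorem mul_mem_zgrading (A : CDGA k) {i j : ℤ} {a b : A.carrier}
    (ha : a ∈ A.zgrading i) (hb : b ∈ A.zgrading j) : a * b ∈ A.zgrading (i + j) := by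
  rcases A.mem_zgrading_iff.1 ha with rfl | ⟨i, rfl, ha⟩
  · simp
  rcases A.mem_zgrading_iff.1 hb with rfl | ⟨j, rfl, hb⟩
  · simp
  exact A.mem_zgrading_iff.2 (Or.inr ⟨i + j, by push_cast; rfl, A.mul_mem ha hb⟩)

theorem zproj_mem (A : CDGA k) (i : ℤ) (a : A.carrier) : A.zproj i a ∈ A.zgrading i := by
  by_cases hi : 0 ≤ i <;> simp [zproj, zgrading, hi]

theorem zproj_of_mem (A : CDGA k) {i : ℤ} {a : A.carrier} (ha : a ∈ A.zgrading i) :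
    A.zproj i a = a := by
  rcases A.mem_zgrading_iff.1 ha with rfl | ⟨i, rfl, ha⟩
  · simp
  · simpa [zproj, DirectSum.component, DFinsupp.lapply,
      DirectSum.decomposeLinearEquiv_apply] using
      DirectSum.decompose_of_mem_same A.grading ha

theorem zproj_of_mem_ne (A : CDGA k) {i j : ℤ} {a : A.carrier} (ha : a ∈ A.zgrading i)
    (hij : i ≠ j) : A.zproj j a = 0 := by
  rcases A.mem_zgrading_iff.1 ha with rfl | ⟨i, rfl, ha⟩
  · simp
  by_cases hj : 0 ≤ j
  · have : i ≠ j.toNat := by omega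
    simpa [zproj, hj, DirectSum.component, DFinsupp.lapply,
      DirectSum.decomposeLinearEquiv_apply] using
      DirectSum.decompose_of_mem_ne A.grading ha this
  · simp [zproj, hj]

/-- A linear map of degree `m` commutes with the projections onto homogeneous parts. -/
theorem zproj_map {A B : CDGA k} (f : A.carrier →ₗ[k] B.carrier) {m : ℤ}
    (hf : ∀ j a, a ∈ A.zgrading j → f a ∈ B.zgrading (j + m)) (i : ℤ) (a : A.carrier) :
    B.zproj i (f a) = f (A.zproj (i - m) a) := by
  induction a using DirectSum.Decomposition.inductionOn A.grading with
  | zero => simp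
  | @homogeneous j a =>
    have ha : (a : A.carrier) ∈ A.zgrading j := (A.mem_zgrading_natCast j).2 a.2
    by_cases hij : (j : ℤ) = i - m
    · rw [← hij, A.zproj_of_mem ha, show i = j + m by omega, B.zproj_of_mem (hf _ _ ha)]
    · rw [A.zproj_of_mem_ne ha hij, map_zero, B.zproj_of_mem_ne (hf _ _ ha) (by omega)]
  | add a b ha hb => simp only [map_add, ha, hb]

theorem zproj_mul_left (A : CDGA k) {m : ℤ} {a : A.carrier} (ha : a ∈ A.zgrading m) (i : ℤ)
    (b : A.carrier) : A.zproj i (a * b) = a * A.zproj (i - m) b :=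
  zproj_map (LinearMap.mulLeft k a)
    (fun j b hb => by simpa [add_comm] using A.mul_mem_zgrading ha hb) i b

theorem zproj_mul_right (A : CDGA k) {m : ℤ} {b : A.carrier} (hb : b ∈ A.zgrading m) (i : ℤ)
    (a : A.carrier) : A.zproj i (a * b) = A.zproj (i - m) a * b :=
  zproj_map (LinearMap.mulRight k b) (fun j a ha => A.mul_mem_zgrading ha hb) i a

/-- Homogeneous elements of even degree are central. -/
theorem commute_of_even (A : CDGA k) {n : ℕ} (hn : Even n) {a : A.carrier}
    (ha : a ∈ A.grading n) (b : A.carrier) : a * b = b * a := by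
  induction b using DirectSum.Decomposition.inductionOn A.grading with
  | zero => simp
  | homogeneous b =>
    rw [A.gcomm ha b.2, (hn.mul_right _).neg_one_pow, one_smul]
  | add b c hb hc => rw [mul_add, add_mul, hb, hc]

theorem d_mul_of_mem (A : CDGA k) {i : ℤ} {a : A.carrier} (ha : a ∈ A.zgrading i) :
    ∃ c : k, c * c = 1 ∧ ∀ b, A.d (a * b) = A.d a * b + c • (a * A.d b) := by
  rcases A.mem_zgrading_iff.1 ha with rfl | ⟨i, rfl, ha⟩
  · exact ⟨1, by simp, by simp⟩
  · exact ⟨(-1) ^ i, by rw [← mul_pow]; simp, A.leibniz ha⟩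

end CDGA

theorem CDGAHom.map_zgrading {A B : CDGA k} (f : CDGAHom A B) {i : ℤ} {a : A.carrier}
    (ha : a ∈ A.zgrading i) : f.toFun a ∈ B.zgrading i := by
  rcases A.mem_zgrading_iff.1 ha with rfl | ⟨i, rfl, ha⟩
  · simp
  · exact (B.mem_zgrading_natCast i).2 (f.map_grading ha)

theorem CDGAHom.zproj_apply {A B : CDGA k} (f : CDGAHom A B) (i : ℤ) (a : A.carrier) :
    B.zproj i (f.toFun a) = f.toFun (A.zproj i a) := by
  simpa using CDGA.zproj_map (m := 0) f.toFun.toLinearMap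
    (fun j a ha => by simpa using f.map_zgrading ha) i a

section MulIdeal

variable (H : CDGA k) {r : ℕ} (e : Fin r → H.carrier)

theorem setOf_val_lt_succ (α : Fin r) :
    {β : Fin r | β.val < α.val + 1} = insert α {β | β.val < α.val} := by
  ext β
  simp only [Set.mem_ofPred_eq, Set.mem_insert_iff, Fin.ext_iff]
  omega

theorem mulIdeal_insert (α : Fin r) (s : Set (Fin r)) :
    mulIdeal H e (insert α s) = LinearMap.range (LinearMap.mulLeft k (e α)) ⊔ mulIdeal H e s := by
  simp only [mulIdeal, iSup_insert]

theorem mul_mem_mulIdeal {α : Fin r} {s : Set (Fin r)} (hα : α ∈ s) (x : H.carrier) :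
    e α * x ∈ mulIdeal H e s :=
  Submodule.mem_iSup_of_mem α (Submodule.mem_iSup_of_mem hα ⟨x, rfl⟩)

variable {H e}

theorem zproj_mem_mulIdeal {n : Fin r → ℕ} (he : ∀ α, e α ∈ H.grading (n α)) (s : Set (Fin r))
    (i : ℤ) {x : H.carrier} (hx : x ∈ mulIdeal H e s) : H.zproj i x ∈ mulIdeal H e s := by
  suffices mulIdeal H e s ≤ (mulIdeal H e s).comap (H.zproj i) from this hx
  refine iSup₂_le fun α hα => ?_
  rintro _ ⟨y, rfl⟩
  simp only [LinearMap.mulLeft_apply, Submodule.mem_comap]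
  rw [H.zproj_mul_left ((H.mem_zgrading_natCast _).2 (he α))]
  exact mul_mem_mulIdeal H e hα _

theorem exists_sub_mul_mem_mulIdeal {n : Fin r → ℕ} (he : ∀ α, e α ∈ H.grading (n α))
    (α : Fin r) {s : Set (Fin r)} {i : ℤ} {x : H.carrier} (hx : x ∈ H.zgrading i)
    (hxI : x ∈ mulIdeal H e (insert α s)) :
    ∃ y ∈ H.zgrading (i - n α), x - e α * y ∈ mulIdeal H e s := by
  rw [mulIdeal_insert, Submodule.mem_sup] at hxI
  obtain ⟨_, ⟨y, rfl⟩, z, hz, rfl⟩ := hxI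
  refine ⟨H.zproj (i - n α) y, H.zproj_mem _ _, ?_⟩
  rw [← H.zproj_mul_left ((H.mem_zgrading_natCast _).2 (he α))]
  nth_rewrite 1 [← H.zproj_of_mem hx]
  simpa using zproj_mem_mulIdeal he s i hz

end MulIdeal

section Hirsch

variable {H A : CDGA k} (φ : CDGAHom H A) {r : ℕ} (t : Fin r → A.carrier)

theorem tmono_empty : tmono A t ∅ = 1 := by
  simp [tmono]

theorem tmono_insert {α : Fin r} {S : Finset (Fin r)} (hS : ∀ β ∈ S, β < α) :
    tmono A t (insert α S) = tmono A t S * t α := by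
  have hα : α ∉ S := fun h => lt_irrefl _ (hS α h)
  have hsort : (insert α S).sort (· ≤ ·) = S.sort (· ≤ ·) ++ [α] := by
    refine List.Perm.eq_of_pairwise' (r := (· ≤ ·)) (Finset.pairwise_sort _ _) ?_ ?_
    · refine List.pairwise_append.2 ⟨Finset.pairwise_sort _ _, by simp, ?_⟩
      simpa using fun β hβ => (hS β hβ).le
    · refine (List.perm_ext_iff_of_nodup (Finset.sort_nodup _ _) ?_).2 fun β => by
        simp [or_comm]
      refine List.nodup_append.2 ⟨Finset.sort_nodup _ _, by simp, ?_⟩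
      simpa using fun β hβ => (hS β hβ).ne
  simp [tmono, hsort]

/-- The indices of the first `s` generators. -/
def firstIndices (r s : ℕ) : Finset (Fin r) :=
  Finset.univ.filter fun β => β.val < s

theorem firstIndices_succ (α : Fin r) :
    firstIndices r (α.val + 1) = insert α (firstIndices r α.val) := by
  ext β
  simp only [firstIndices, Finset.mem_filter, Finset.mem_univ, true_and, Finset.mem_insert,
    Fin.ext_iff]
  omega

theorem notMem_firstIndices (α : Fin r) : α ∉ firstIndices r α.val := by
  simp [firstIndices]

theorem lt_of_subset_firstIndices {α : Fin r} {S : Finset (Fin r)}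
    (hS : S ⊆ firstIndices r α.val) : ∀ β ∈ S, β < α := fun β hβ => by
  simpa [firstIndices] using hS hβ

/-- The map sending a family of coefficients to the corresponding combination of monomials in the
first `s` generators. -/
def stageMap (s : ℕ) : (Finset (Fin r) → H.carrier) →ₗ[k] A.carrier :=
  ∑ S ∈ (firstIndices r s).powerset,
    LinearMap.mulRight k (tmono A t S) ∘ₗ φ.toFun.toLinearMap ∘ₗ LinearMap.proj S

theorem stageMap_apply (s : ℕ) (c : Finset (Fin r) → H.carrier) :
    stageMap φ t s c = ∑ S ∈ (firstIndices r s).powerset, φ.toFun (c S) * tmono A t S := by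
  simp [stageMap]

/-- The `H`-submodule of a Hirsch extension spanned by the monomials in the first `s`
generators. -/
def stage (s : ℕ) : Submodule k A.carrier :=
  LinearMap.range (stageMap φ t s)

theorem stageMap_zero (c : Finset (Fin r) → H.carrier) :
    stageMap φ t 0 c = φ.toFun (c ∅) := by
  simp [stageMap_apply, firstIndices, tmono_empty]

theorem stageMap_succ (α : Fin r) (c : Finset (Fin r) → H.carrier) :
    stageMap φ t (α.val + 1) c =
      stageMap φ t α.val c + stageMap φ t α.val (fun S => c (insert α S)) * t α := by
  simp only [stageMap_apply]
  rw [firstIndices_succ, Finset.sum_powerset_insert (notMem_firstIndices α), Finset.sum_mul]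
  congr 1
  refine Finset.sum_congr rfl fun S hS => ?_
  rw [tmono_insert t (lt_of_subset_firstIndices (Finset.mem_powerset.1 hS)), mul_assoc]

theorem stageMap_congr {s : ℕ} {c c' : Finset (Fin r) → H.carrier}
    (h : ∀ S ⊆ firstIndices r s, c S = c' S) : stageMap φ t s c = stageMap φ t s c' := by
  simp only [stageMap_apply]
  exact Finset.sum_congr rfl fun S hS => by rw [h S (Finset.mem_powerset.1 hS)]

theorem exists_of_mem_stage_zero {a : A.carrier} (ha : a ∈ stage φ t 0) :
    ∃ h, φ.toFun h = a := by
  obtain ⟨c, rfl⟩ := ha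
  exact ⟨c ∅, (stageMap_zero φ t c).symm⟩

theorem exists_of_mem_stage_succ {α : Fin r} {a : A.carrier}
    (ha : a ∈ stage φ t (α.val + 1)) :
    ∃ x ∈ stage φ t α.val, ∃ y ∈ stage φ t α.val, x + y * t α = a := by
  obtain ⟨c, rfl⟩ := ha
  exact ⟨_, ⟨_, rfl⟩, _, ⟨_, rfl⟩, (stageMap_succ φ t α c).symm⟩

theorem stageMap_combine (α : Fin r) (c c' : Finset (Fin r) → H.carrier) :
    stageMap φ t (α.val + 1) (fun S => if α ∈ S then c' (S.erase α) else c S) =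
      stageMap φ t α.val c + stageMap φ t α.val c' * t α := by
  have hα : ∀ S ⊆ firstIndices r α.val, α ∉ S := fun S hS h => notMem_firstIndices α (hS h)
  rw [stageMap_succ]
  congr 1
  · exact stageMap_congr φ t fun S hS => by simp [hα S hS]
  · congr 1
    exact stageMap_congr φ t fun S hS => by simp [hα S hS]

theorem add_mul_mem_stage_succ {α : Fin r} {x y : A.carrier} (hx : x ∈ stage φ t α.val)
    (hy : y ∈ stage φ t α.val) : x + y * t α ∈ stage φ t (α.val + 1) := by
  obtain ⟨c, rfl⟩ := hx
  obtain ⟨c', rfl⟩ := hy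
  exact ⟨_, stageMap_combine φ t α c c'⟩

theorem mem_stage_succ {α : Fin r} {x : A.carrier} (hx : x ∈ stage φ t α.val) :
    x ∈ stage φ t (α.val + 1) := by
  simpa using add_mul_mem_stage_succ φ t hx (zero_mem _)

theorem mul_mem_stage_succ {α : Fin r} {y : A.carrier} (hy : y ∈ stage φ t α.val) :
    y * t α ∈ stage φ t (α.val + 1) := by
  simpa using add_mul_mem_stage_succ φ t (zero_mem _) hy

theorem map_mul_stageMap (s : ℕ) (h : H.carrier) (c : Finset (Fin r) → H.carrier) :
    φ.toFun h * stageMap φ t s c = stageMap φ t s (fun S => h * c S) := by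
  simp only [stageMap_apply, Finset.mul_sum, map_mul, mul_assoc]

theorem map_mul_mem_stage {s : ℕ} (h : H.carrier) {a : A.carrier} (ha : a ∈ stage φ t s) :
    φ.toFun h * a ∈ stage φ t s := by
  obtain ⟨c, rfl⟩ := ha
  exact ⟨_, (map_mul_stageMap φ t s h c).symm⟩

theorem stageMap_single_empty (s : ℕ) (h : H.carrier) :
    stageMap φ t s (Pi.single ∅ h) = φ.toFun h := by
  rw [stageMap_apply, Finset.sum_eq_single ∅]
  · simp [tmono_empty]
  · intro S _ hS
    simp [hS]
  · simp

theorem map_mem_stage (s : ℕ) (h : H.carrier) : φ.toFun h ∈ stage φ t s :=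
  ⟨_, stageMap_single_empty φ t s h⟩

/-- An element of the `s`-th stage may be rewritten with coefficients vanishing outside of it. -/
theorem stageMap_eq_stageMap_top (s : ℕ) (c : Finset (Fin r) → H.carrier) :
    stageMap φ t s c =
      stageMap φ t r (fun S => if S ⊆ firstIndices r s then c S else 0) := by
  have htop : (firstIndices r r).powerset = Finset.univ := by simp [firstIndices]
  simp only [stageMap_apply, htop]
  rw [← Finset.sum_subset (Finset.subset_univ (firstIndices r s).powerset)]
  · exact Finset.sum_congr rfl fun S hS => by simp [Finset.mem_powerset.1 hS]
  · intro S _ hS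
    simp [Finset.mem_powerset.not.1 hS]

namespace IsHirsch

variable {φ t} {m : Fin r → ℕ} {e : Fin r → H.carrier}

theorem stageMap_bijective (hA : IsHirsch H A φ m t e) :
    Function.Bijective (stageMap φ t r) := by
  refine Function.bijective_iff_existsUnique _ |>.2 fun a => ?_
  simpa [stageMap_apply, firstIndices, eq_comm] using hA.free a

theorem mem_stage_top (hA : IsHirsch H A φ m t e) (a : A.carrier) : a ∈ stage φ t r :=
  hA.stageMap_bijective.2 a

/-- The coefficients of the elements of a Hirsch extension in the monomial basis. -/
def coeff (hA : IsHirsch H A φ m t e) : A.carrier →ₗ[k] (Finset (Fin r) → H.carrier) :=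
  (LinearEquiv.ofBijective _ hA.stageMap_bijective).symm.toLinearMap

theorem coeff_stageMap (hA : IsHirsch H A φ m t e) (s : ℕ) (c : Finset (Fin r) → H.carrier) :
    hA.coeff (stageMap φ t s c) = fun S => if S ⊆ firstIndices r s then c S else 0 := by
  rw [stageMap_eq_stageMap_top]
  exact (LinearEquiv.ofBijective _ hA.stageMap_bijective).symm_apply_apply _

theorem eq_zero_of_add_mul_eq_zero (hA : IsHirsch H A φ m t e) {α : Fin r} {x y : A.carrier}
    (hx : x ∈ stage φ t α.val) (hy : y ∈ stage φ t α.val) (h : x + y * t α = 0) :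
    x = 0 ∧ y = 0 := by
  obtain ⟨c, rfl⟩ := hx
  obtain ⟨c', rfl⟩ := hy
  have hα : ∀ S ⊆ firstIndices r α.val, α ∉ S := fun S hS h => notMem_firstIndices α (hS h)
  have hc := congrArg hA.coeff h
  rw [← stageMap_combine, hA.coeff_stageMap, map_zero, firstIndices_succ] at hc
  constructor
  · rw [stageMap_congr φ t (c' := 0) fun S hS => ?_, map_zero]
    simpa [hS.trans (Finset.subset_insert _ _), hα S hS] using congrFun hc S
  · rw [stageMap_congr φ t (c' := 0) fun S hS => ?_, map_zero]
    simpa [Finset.insert_subset_insert α hS, hα S hS] using congrFun hc (insert α S)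

/-- The coefficient of the monomial `1` in a Hirsch extension. -/
def augmentation (hA : IsHirsch H A φ m t e) : A.carrier →ₗ[k] H.carrier :=
  LinearMap.proj ∅ ∘ₗ hA.coeff

theorem augmentation_stageMap (hA : IsHirsch H A φ m t e) (s : ℕ)
    (c : Finset (Fin r) → H.carrier) : hA.augmentation (stageMap φ t s c) = c ∅ := by
  simp [augmentation, hA.coeff_stageMap]

theorem augmentation_map (hA : IsHirsch H A φ m t e) (h : H.carrier) :
    hA.augmentation (φ.toFun h) = h := by
  rw [← stageMap_single_empty φ t r, hA.augmentation_stageMap, Pi.single_eq_same]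

theorem augmentation_map_mul (hA : IsHirsch H A φ m t e) (h : H.carrier) (a : A.carrier) :
    hA.augmentation (φ.toFun h * a) = h * hA.augmentation a := by
  obtain ⟨c, rfl⟩ := hA.mem_stage_top a
  rw [map_mul_stageMap, hA.augmentation_stageMap, hA.augmentation_stageMap]

theorem augmentation_mul (hA : IsHirsch H A φ m t e) {α : Fin r} {y : A.carrier}
    (hy : y ∈ stage φ t α.val) : hA.augmentation (y * t α) = 0 := by
  obtain ⟨c, rfl⟩ := hy
  have h := stageMap_combine φ t α 0 c
  rw [map_zero, zero_add] at h
  rw [← h, hA.augmentation_stageMap]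
  simp

theorem zproj_mem_stage (hA : IsHirsch H A φ m t e) {s : ℕ} (hs : s ≤ r) (i : ℤ)
    {a : A.carrier} (ha : a ∈ stage φ t s) : A.zproj i a ∈ stage φ t s := by
  induction s generalizing i a with
  | zero =>
    obtain ⟨h, rfl⟩ := exists_of_mem_stage_zero φ t ha
    rw [φ.zproj_apply]
    exact map_mem_stage φ t 0 _
  | succ s ih =>
    obtain ⟨x, hx, y, hy, rfl⟩ := exists_of_mem_stage_succ φ t (α := ⟨s, hs⟩) ha
    rw [map_add, A.zproj_mul_right ((A.mem_zgrading_natCast _).2 (hA.t_mem _))]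
    exact add_mul_mem_stage_succ φ t (α := ⟨s, hs⟩) (ih (by omega) _ hx) (ih (by omega) _ hy)

theorem exists_of_mem_stage_succ_of_mem_zgrading (hA : IsHirsch H A φ m t e) {α : Fin r} {i : ℤ}
    {a : A.carrier} (ha : a ∈ stage φ t (α.val + 1)) (hai : a ∈ A.zgrading i) :
    ∃ x ∈ stage φ t α.val, x ∈ A.zgrading i ∧
      ∃ y ∈ stage φ t α.val, y ∈ A.zgrading (i - m α) ∧ x + y * t α = a := by
  obtain ⟨x, hx, y, hy, rfl⟩ := exists_of_mem_stage_succ φ t ha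
  refine ⟨A.zproj i x, hA.zproj_mem_stage α.2.le i hx, A.zproj_mem _ _,
    A.zproj (i - m α) y, hA.zproj_mem_stage α.2.le _ hy, A.zproj_mem _ _, ?_⟩
  rw [← A.zproj_mul_right ((A.mem_zgrading_natCast _).2 (hA.t_mem _)), ← map_add,
    A.zproj_of_mem hai]

theorem map_e_comm (hA : IsHirsch H A φ m t e) (α : Fin r) (a : A.carrier) :
    a * φ.toFun (e α) = φ.toFun (e α) * a :=
  (A.commute_of_even (hA.odd_deg α).add_one (φ.map_grading (hA.e_cocycle α).1) a).symm

theorem d_mul_generator (hA : IsHirsch H A φ m t e) (α : Fin r) {i : ℤ} {y : A.carrier}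
    (hy : y ∈ A.zgrading i) :
    ∃ c : k, c * c = 1 ∧ A.d (y * t α) = A.d y * t α + c • (φ.toFun (e α) * y) := by
  obtain ⟨c, hc, h⟩ := A.d_mul_of_mem hy
  exact ⟨c, hc, by rw [h, hA.dt, hA.map_e_comm]⟩

theorem augmentation_mem_zgrading (hA : IsHirsch H A φ m t e) {i : ℤ} {a : A.carrier}
    (ha : a ∈ A.zgrading i) : hA.augmentation a ∈ H.zgrading i := by
  suffices ∀ s ≤ r, ∀ a ∈ stage φ t s, hA.augmentation (A.zproj i a) ∈ H.zgrading i by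
    simpa [A.zproj_of_mem ha] using this r le_rfl a (hA.mem_stage_top a)
  intro s hs
  induction s with
  | zero =>
    intro a ha
    obtain ⟨h, rfl⟩ := exists_of_mem_stage_zero φ t ha
    rw [φ.zproj_apply, hA.augmentation_map]
    exact H.zproj_mem _ _
  | succ s ih =>
    intro a ha
    obtain ⟨x, hx, y, hy, rfl⟩ := exists_of_mem_stage_succ φ t (α := ⟨s, hs⟩) ha
    rw [map_add, A.zproj_mul_right ((A.mem_zgrading_natCast _).2 (hA.t_mem _)), map_add,
      hA.augmentation_mul (hA.zproj_mem_stage (by omega) _ hy), add_zero]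
    exact ih (by omega) x hx

theorem d_mem_stage (hA : IsHirsch H A φ m t e) {s : ℕ} (hs : s ≤ r) {i : ℤ} {a : A.carrier}
    (ha : a ∈ stage φ t s) (hai : a ∈ A.zgrading i) : A.d a ∈ stage φ t s := by
  induction s generalizing i a with
  | zero =>
    obtain ⟨h, rfl⟩ := exists_of_mem_stage_zero φ t ha
    rw [← φ.map_d]
    exact map_mem_stage φ t 0 _
  | succ s ih =>
    obtain ⟨x, hx, hxi, y, hy, hyi, rfl⟩ :=
      hA.exists_of_mem_stage_succ_of_mem_zgrading (α := ⟨s, hs⟩) ha hai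
    obtain ⟨c, -, hc⟩ := hA.d_mul_generator ⟨s, hs⟩ hyi
    rw [map_add, hc, add_comm (A.d y * _), ← add_assoc]
    exact add_mul_mem_stage_succ φ t (α := ⟨s, hs⟩)
      (add_mem (ih (by omega) hx hxi) (Submodule.smul_mem _ _ (map_mul_mem_stage φ t _ hy)))
      (ih (by omega) hy hyi)

theorem augmentation_d_mem (hA : IsHirsch H A φ m t e) (hHd : H.d = 0) {s : ℕ} (hs : s ≤ r)
    {i : ℤ} {a : A.carrier} (ha : a ∈ stage φ t s) (hai : a ∈ A.zgrading i) :
    hA.augmentation (A.d a) ∈ mulIdeal H e {β | β.val < s} := by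
  induction s generalizing i a with
  | zero =>
    obtain ⟨h, rfl⟩ := exists_of_mem_stage_zero φ t ha
    simp [← φ.map_d, hHd]
  | succ s ih =>
    obtain ⟨x, hx, hxi, y, hy, hyi, rfl⟩ :=
      hA.exists_of_mem_stage_succ_of_mem_zgrading (α := ⟨s, hs⟩) ha hai
    obtain ⟨c, -, hc⟩ := hA.d_mul_generator ⟨s, hs⟩ hyi
    rw [map_add, hc, map_add, map_add, map_smul, hA.augmentation_map_mul,
      hA.augmentation_mul (hA.d_mem_stage (by omega) hy hyi), zero_add]
    refine add_mem ?_ (Submodule.smul_mem _ _ (mul_mem_mulIdeal H e (by simp) _))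
    rw [setOf_val_lt_succ ⟨s, hs⟩, mulIdeal_insert]
    exact Submodule.mem_sup_right (ih (by omega) hx hxi)

/-- A morphism out of a Hirsch extension which kills the generators factors through the
augmentation. -/
theorem apply_eq_apply_augmentation (hA : IsHirsch H A φ m t e) {Q : CDGA k} (ψ : CDGAHom A Q)
    (hψt : ∀ α, ψ.toFun (t α) = 0) (a : A.carrier) :
    ψ.toFun a = ψ.toFun (φ.toFun (hA.augmentation a)) := by
  suffices ∀ s ≤ r, ∀ a ∈ stage φ t s, ψ.toFun a = ψ.toFun (φ.toFun (hA.augmentation a)) from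
    this r le_rfl a (hA.mem_stage_top a)
  intro s hs
  induction s with
  | zero =>
    intro a ha
    obtain ⟨h, rfl⟩ := exists_of_mem_stage_zero φ t ha
    rw [hA.augmentation_map]
  | succ s ih =>
    intro a ha
    obtain ⟨x, hx, y, hy, rfl⟩ := exists_of_mem_stage_succ φ t (α := ⟨s, hs⟩) ha
    rw [map_add, map_mul, hψt, mul_zero, add_zero, map_add, hA.augmentation_mul hy, add_zero]
    exact ih (by omega) x hx

/-- A cocycle of degree at most `q + 1` in the `s`-th stage of the Hirsch extension defined by a
`q`-regular sequence is exact as soon as its augmentation lies in the ideal generated by the first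
`s` elements of the sequence. -/
theorem exists_d_eq (hA : IsHirsch H A φ m t e) (hHd : H.d = 0) {q : ℕ}
    (hreg : QRegular H q (fun α => m α + 1) e) {s : ℕ} (hs : s ≤ r) {i : ℤ} (hi : i ≤ q + 1)
    {a : A.carrier} (ha : a ∈ stage φ t s) (hai : a ∈ A.zgrading i) (hda : A.d a = 0)
    (haI : hA.augmentation a ∈ mulIdeal H e {β | β.val < s}) :
    ∃ b ∈ stage φ t s, b ∈ A.zgrading (i - 1) ∧ A.d b = a := by
  induction s generalizing i a with
  | zero =>
    obtain ⟨h, rfl⟩ := exists_of_mem_stage_zero φ t ha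
    rw [hA.augmentation_map] at haI
    have : h = 0 := by simpa [mulIdeal] using haI
    exact ⟨0, zero_mem _, zero_mem _, by simp [this]⟩
  | succ s ih =>
    obtain ⟨α, rfl⟩ : ∃ α : Fin r, α.val = s := ⟨⟨s, hs⟩, rfl⟩
    have heα : e α ∈ H.zgrading (m α + 1) :=
      (H.mem_zgrading_natCast (m α + 1)).2 (hA.e_cocycle α).1
    have htα : t α ∈ A.zgrading (m α) := (A.mem_zgrading_natCast _).2 (hA.t_mem α)
    obtain ⟨x, hx, hxi, y, hy, hyi, rfl⟩ := hA.exists_of_mem_stage_succ_of_mem_zgrading ha hai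
    obtain ⟨c, hc, hdy⟩ := hA.d_mul_generator α hyi
    obtain ⟨hdx, hdy0⟩ : A.d x + c • (φ.toFun (e α) * y) = 0 ∧ A.d y = 0 := by
      refine hA.eq_zero_of_add_mul_eq_zero (add_mem (hA.d_mem_stage α.2.le hx hxi)
        (Submodule.smul_mem _ _ (map_mul_mem_stage φ t _ hy))) (hA.d_mem_stage α.2.le hy hyi) ?_
      rw [← hda, map_add, hdy]
      abel
    have hyI : hA.augmentation y ∈ mulIdeal H e {β | β.val < α.val} := by
      rcases H.mem_zgrading_iff.1 (hA.augmentation_mem_zgrading hyi) with h0 | ⟨j, hj, hyj⟩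
      · rw [h0]
        exact zero_mem _
      refine hreg α j (by push_cast; omega) _ hyj ?_
      have h := congrArg hA.augmentation hdx
      rw [map_add, map_smul, hA.augmentation_map_mul, map_zero] at h
      have h' : e α * hA.augmentation y = -(c • hA.augmentation (A.d x)) := by
        rw [eq_neg_of_add_eq_zero_left h, smul_neg, smul_smul, hc, one_smul, neg_neg]
      rw [h']
      exact neg_mem (Submodule.smul_mem _ _ (hA.augmentation_d_mem hHd α.2.le hx hxi))
    obtain ⟨z, hz, hzi, rfl⟩ := ih α.2.le (by omega) hy hyi hdy0 hyI
    obtain ⟨c', -, hdz⟩ := hA.d_mul_generator α hzi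
    have hez : φ.toFun (e α) * z ∈ A.zgrading i := by
      convert A.mul_mem_zgrading (φ.map_zgrading heα) hzi using 2
      ring
    have hxz : x - c' • (φ.toFun (e α) * z) ∈ A.zgrading i :=
      sub_mem hxi (Submodule.smul_mem _ _ hez)
    have hxzI : hA.augmentation (x - c' • (φ.toFun (e α) * z)) ∈
        mulIdeal H e (insert α {β | β.val < α.val}) := by
      rw [map_add, hA.augmentation_mul hy, add_zero, setOf_val_lt_succ] at haI
      rw [map_sub, map_smul, hA.augmentation_map_mul]
      exact sub_mem haI (Submodule.smul_mem _ _ (mul_mem_mulIdeal H e (Set.mem_insert _ _) _))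
    obtain ⟨h, hhi, hhI⟩ := exists_sub_mul_mem_mulIdeal (n := fun α => m α + 1)
      (fun α => (hA.e_cocycle α).1) α (hA.augmentation_mem_zgrading hxz) hxzI
    push_cast at hhi
    obtain ⟨c'', hc'', hdh⟩ := hA.d_mul_generator α (φ.map_zgrading hhi)
    rw [← φ.map_d, hHd, LinearMap.zero_apply, map_zero, zero_mul, zero_add, ← map_mul] at hdh
    have heh : e α * h ∈ H.zgrading i := by
      convert H.mul_mem_zgrading heα hhi using 2
      ring
    obtain ⟨w, hw, hwi, hdw⟩ := ih α.2.le hi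
      (a := x - c' • (φ.toFun (e α) * z) - φ.toFun (e α * h))
      (sub_mem (sub_mem hx (Submodule.smul_mem _ _ (map_mul_mem_stage φ t _ hz)))
        (map_mem_stage φ t _ _))
      (sub_mem hxz (φ.map_zgrading heh))
      (by
        have hdeh : A.d (φ.toFun (e α * h)) = 0 := by rw [← φ.map_d, hHd]; simp
        have hxz' : x - c' • (φ.toFun (e α) * z) = x + A.d z * t α - A.d (z * t α) := by
          rw [hdz]
          abel
        rw [map_sub, hdeh, sub_zero, hxz', map_sub, hda, A.d_d, sub_zero])
      (by rwa [map_sub, hA.augmentation_map])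
    refine ⟨w + z * t α + c'' • (φ.toFun h * t α), ?_, ?_, ?_⟩
    · exact add_mem (add_mem (mem_stage_succ φ t hw) (mul_mem_stage_succ φ t hz))
        (Submodule.smul_mem _ _ (mul_mem_stage_succ φ t (map_mem_stage φ t _ _)))
    · refine add_mem (add_mem hwi ?_) (Submodule.smul_mem _ _ ?_)
      · convert A.mul_mem_zgrading hzi htα using 2
        ring
      · convert A.mul_mem_zgrading (φ.map_zgrading hhi) htα using 2
        ring
    · rw [map_add, map_add, map_smul, hdw, hdz, hdh, smul_smul, hc'', one_smul]
      abel

end IsHirsch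

end Hirsch

/-- Let `H` be a connected commutative graded `k`-algebra (a CDGA with zero
differential), and let `e_1, …, e_r` be a `q`-regular sequence of homogeneous elements of even
positive degrees `n_α`.  Let `A = H ⊗_τ Λ(t_1, …, t_r)` be the Hirsch extension with
`deg t_α = n_α - 1` and `d t_α = e_α`.  Then the CDGA morphism
`ψ : A → (H/Σ_α e_α H, d = 0)` restricting to the canonical projection `π` on `H` and killing
each `t_α` is a `q`-equivalence; in particular `A` has the same `q`-type as
`(H/Σ_α e_α H, d = 0)`, so `A` is `q`-formal. -/
theorem statement0 (H A Q : CDGA k)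
    (hHd : H.d = 0) (hHconn : H.Connected) (hQd : Q.d = 0)
    (q : ℕ) (r : ℕ) (n : Fin r → ℕ) (e : Fin r → H.carrier)
    (hn_even : ∀ α, Even (n α)) (hn_pos : ∀ α, 0 < n α)
    (he_mem : ∀ α, e α ∈ H.grading (n α))
    (hreg : QRegular H q n e)
    (φ : CDGAHom H A) (t : Fin r → A.carrier)
    (hhir : IsHirsch H A φ (fun α => n α - 1) t e)
    (π : CDGAHom H Q) (hπsurj : Function.Surjective π.toFun)
    (hπker : LinearMap.ker π.toFun.toLinearMap = mulIdeal H e Set.univ)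
    (ψ : CDGAHom A Q)
    (hψφ : ∀ h : H.carrier, ψ.toFun (φ.toFun h) = π.toFun h)
    (hψt : ∀ α, ψ.toFun (t α) = 0) :
    ψ.IsQEquiv q := by
  have hn : ∀ α, n α - 1 + 1 = n α := fun α => Nat.sub_add_cancel (hn_pos α)
  refine ⟨fun i _ b hb => ?_, fun i hi a ha hψa => ?_⟩
  · obtain ⟨h, rfl⟩ := hπsurj b
    refine ⟨φ.toFun (H.zproj i h), ⟨φ.map_grading ?_, ?_⟩, ?_⟩
    · exact (H.mem_zgrading_natCast i).1 (H.zproj_mem i h)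
    · simp [← φ.map_d, hHd]
    · rw [hψφ, ← π.zproj_apply, Q.zproj_of_mem ((Q.mem_zgrading_natCast i).2 hb.1), sub_self]
      exact zero_mem _
  · have hψ0 : ψ.toFun a = 0 := by
      cases i with
      | zero => simpa [CDGA.Bc] using hψa
      | succ i =>
        obtain ⟨b, -, hb⟩ := hψa
        simpa [hQd] using hb.symm
    have haI : hhir.augmentation a ∈ mulIdeal H e {β | β.val < r} := by
      have hr : {β : Fin r | β.val < r} = Set.univ := Set.eq_univ_of_forall fun β => β.2
      rw [hr, ← hπker, LinearMap.mem_ker, AlgHom.toLinearMap_apply, ← hψφ,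
        ← hhir.apply_eq_apply_augmentation ψ hψt, hψ0]
    obtain ⟨b, -, hbi, rfl⟩ := hhir.exists_d_eq hHd (by simpa only [hn] using hreg) le_rfl
      (i := i) (by omega) (hhir.mem_stage_top a) ((A.mem_zgrading_natCast i).2 ha.1) ha.2 haI
    rcases A.mem_zgrading_iff.1 hbi with rfl | ⟨j, hj, hbj⟩
    · rw [map_zero]
      exact zero_mem _
    · obtain rfl : i = j + 1 := by omega
      exact ⟨b, hbj, rfl⟩

end Statement0
end
end

section
/- Two trace-zero 2×2 matrices g, g' ∈ sl₂(k) over a field k of characteristic 0 commute (i.e. gg' = g'g) if and only if they are linearly dependent over k, i.e. the k-linear span of {g, g'} has dimension at most 1. -/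
/-- A trace-zero `2×2` matrix commuting with a nonzero trace-zero matrix is a multiple of it. -/
theorem exists_eq_smul_of_commute_of_trace_eq_zero {k : Type*} [Field k] [CharZero k]
    {g g' : Matrix (Fin 2) (Fin 2) k} (hg : g.trace = 0) (hg' : g'.trace = 0)
    (hne : g ≠ 0) (h : g * g' = g' * g) : ∃ c : k, g' = c • g := by
  rw [Matrix.trace_fin_two] at hg hg'
  have hd : g 1 1 = -g 0 0 := by linear_combination hg
  have hd' : g' 1 1 = -g' 0 0 := by linear_combination hg'
  have h00 := congrFun (congrFun h 0) 0
  have h01 := congrFun (congrFun h 0) 1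
  have h10 := congrFun (congrFun h 1) 0
  simp only [Matrix.mul_apply, Fin.sum_univ_two, hd, hd'] at h00 h01 h10
  have two_ne : (2 : k) ≠ 0 := two_ne_zero
  have e₁ : g 0 0 * g' 0 1 = g 0 1 * g' 0 0 :=
    mul_left_cancel₀ two_ne (by linear_combination h01)
  have e₂ : g 0 0 * g' 1 0 = g 1 0 * g' 0 0 :=
    mul_left_cancel₀ two_ne (by linear_combination -h10)
  have e₃ : g 0 1 * g' 1 0 = g 1 0 * g' 0 1 := by linear_combination h00
  have ext_smul (c : k) (h₁ : g' 0 0 = c * g 0 0) (h₂ : g' 0 1 = c * g 0 1)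
      (h₃ : g' 1 0 = c * g 1 0) : g' = c • g := by
    ext i j
    fin_cases i <;> fin_cases j <;> simp [h₁, h₂, h₃, hd, hd']
  by_cases ha : g 0 0 = 0
  · by_cases hb : g 0 1 = 0
    · have hc : g 1 0 ≠ 0 := by
        intro hc
        apply hne
        ext i j
        fin_cases i <;> fin_cases j <;> simp [ha, hb, hc, hd]
      refine ⟨g' 1 0 / g 1 0, ext_smul _ ?_ ?_ ?_⟩ <;> field_simp
      · linear_combination -e₂
      · linear_combination -e₃
    · refine ⟨g' 0 1 / g 0 1, ext_smul _ ?_ ?_ ?_⟩ <;> field_simp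
      · linear_combination -e₁
      · linear_combination e₃
  · refine ⟨g' 0 0 / g 0 0, ext_smul _ ?_ ?_ ?_⟩ <;> field_simp
    · linear_combination e₁
    · linear_combination e₂

/-- Two trace-zero `2×2` matrices `g, g'` over a field `k` of characteristic
zero commute if and only if they are linearly dependent over `k`, i.e. the `k`-linear span of
`{g, g'}` has dimension at most 1. -/
theorem statement5 {k : Type*} [Field k] [CharZero k]
    (g g' : Matrix (Fin 2) (Fin 2) k)
    (hg : Matrix.trace g = 0) (hg' : Matrix.trace g' = 0) :
    g * g' = g' * g ↔
      Module.rank k ↥(Submodule.span k ({g, g'} : Set (Matrix (Fin 2) (Fin 2) k))) ≤ 1 := by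
  rw [rank_submodule_le_one_iff]
  constructor
  · intro h
    by_cases hne : g = 0
    · refine ⟨g', Submodule.subset_span (by simp), Submodule.span_le.2 ?_⟩
      rintro x (rfl | rfl)
      · simp [hne]
      · exact Submodule.mem_span_singleton_self _
    · obtain ⟨c, rfl⟩ := exists_eq_smul_of_commute_of_trace_eq_zero hg hg' hne h
      refine ⟨g, Submodule.subset_span (by simp), Submodule.span_le.2 ?_⟩
      rintro x (rfl | rfl)
      · exact Submodule.mem_span_singleton_self _
      · exact Submodule.smul_mem _ _ (Submodule.mem_span_singleton_self _)
  · rintro ⟨v, -, hv⟩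
    obtain ⟨a, rfl⟩ := Submodule.mem_span_singleton.1
      (hv (Submodule.subset_span (Set.mem_insert _ _)))
    obtain ⟨b, rfl⟩ := Submodule.mem_span_singleton.1
      (hv (Submodule.subset_span (Set.mem_insert_of_mem _ rfl)))
    exact ((Commute.refl v).smul_left a).smul_right b
end

section
/- Let B be a connected CDGA over k and let e ∈ Z²(B) with [e] ≠ 0 in H²(B), and let A = B ⊗_e Λ(t) be the Hirsch extension with one generator t of degree 1 and dt = e. Then Z¹(A) = Z¹(B), and for all i ≥ 0 and s ≥ 0 the rank-one resonance varieties satisfy ℛ^i_s(A) ⊆ ℛ^{i−1}_1(B) ∪ ℛ^i_s(B), as subsets of Z¹(B). -/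
noncomputable section
set_option synthInstance.maxHeartbeats 1000000
set_option maxHeartbeats 1600000
set_option linter.unusedVariables false

open scoped TensorProduct

universe u v

section RankOne

variable {k : Type u} [Field k]

/-- The covariant derivative `d_ω = d + ω·(-)` associated to a rank-one flat connection. -/
def covD (A : CDGA k) (ω : A.carrier) : A.carrier →ₗ[k] A.carrier :=
  A.d + LinearMap.mulLeft k ω

/-- `d_ω`-cocycles in degree `i`. -/
def ZcOm (A : CDGA k) (ω : A.carrier) (i : ℕ) : Submodule k A.carrier :=
  A.grading i ⊓ LinearMap.ker (covD A ω)

/-- `d_ω`-coboundaries in degree `i`. -/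
def BcOm (A : CDGA k) (ω : A.carrier) : ℕ → Submodule k A.carrier
  | 0 => ⊥
  | (i + 1) => (A.grading i).map (covD A ω)

/-- The cohomology `H^i(A, d_ω)`. -/
abbrev cohOm (A : CDGA k) (ω : A.carrier) (i : ℕ) :=
  ↥(ZcOm A ω i) ⧸ (Submodule.comap (ZcOm A ω i).subtype (BcOm A ω i))

/-- The rank-one resonance variety `ℛ^i_s(A) = {ω ∈ Z¹(A) | dim H^i(A,d_ω) ≥ s}`. -/
def res1 (A : CDGA k) (i s : ℕ) : Set A.carrier :=
  {ω | ω ∈ A.Zc 1 ∧ (s : Cardinal) ≤ Module.rank k (cohOm A ω i)}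

end RankOne

section HirschRankOne

variable {k : Type u} [Field k]

namespace CDGA

/-- The projection of a CDGA onto its component of degree `i`. -/
def proj (A : CDGA k) (i : ℕ) : A.carrier →ₗ[k] A.carrier :=
  letI := A.decomp
  (A.grading i).subtype ∘ₗ DirectSum.component k ℕ (fun j => A.grading j) i ∘ₗ
    (DirectSum.decomposeLinearEquiv A.grading).toLinearMap

lemma proj_mem (A : CDGA k) (i : ℕ) (a : A.carrier) : A.proj i a ∈ A.grading i :=
  SetLike.coe_mem _

lemma proj_of_mem (A : CDGA k) {i : ℕ} {a : A.carrier} (ha : a ∈ A.grading i) :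
    A.proj i a = a :=
  letI := A.decomp
  DirectSum.decompose_of_mem_same A.grading ha

lemma proj_of_mem_ne (A : CDGA k) {i j : ℕ} {a : A.carrier} (ha : a ∈ A.grading i)
    (hij : i ≠ j) : A.proj j a = 0 :=
  letI := A.decomp
  DirectSum.decompose_of_mem_ne A.grading ha hij

lemma induction_homogeneous (A : CDGA k) {p : A.carrier → Prop} (zero : p 0)
    (homogeneous : ∀ i, ∀ a ∈ A.grading i, p a)
    (add : ∀ a b, p a → p b → p (a + b)) (a : A.carrier) : p a :=
  letI := A.decomp
  DirectSum.Decomposition.inductionOn A.grading zero (fun m => homogeneous _ m m.2) add a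

lemma proj_map_add (A B : CDGA k) (f : B.carrier →ₗ[k] A.carrier) (r : ℕ)
    (hf : ∀ i, ∀ b ∈ B.grading i, f b ∈ A.grading (i + r)) (i : ℕ) (b : B.carrier) :
    A.proj (i + r) (f b) = f (B.proj i b) := by
  induction b using B.induction_homogeneous with
  | zero => simp
  | homogeneous j b hb =>
    obtain rfl | hij := eq_or_ne j i
    · rw [B.proj_of_mem hb, A.proj_of_mem (hf _ _ hb)]
    · rw [B.proj_of_mem_ne hb hij, A.proj_of_mem_ne (hf _ _ hb) (by omega), map_zero]
  | add a b ha hb => simp only [map_add, ha, hb]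

lemma proj_map_of_lt (A B : CDGA k) (f : B.carrier →ₗ[k] A.carrier) (r : ℕ)
    (hf : ∀ i, ∀ b ∈ B.grading i, f b ∈ A.grading (i + r)) {i : ℕ} (hi : i < r)
    (b : B.carrier) : A.proj i (f b) = 0 := by
  induction b using B.induction_homogeneous with
  | zero => simp
  | homogeneous j b hb => exact A.proj_of_mem_ne (hf _ _ hb) (by omega)
  | add a b ha hb => simp only [map_add, ha, hb, add_zero]

end CDGA

lemma covD_apply (A : CDGA k) (ω a : A.carrier) : covD A ω a = A.d a + ω * a := rfl

lemma covD_mul (A : CDGA k) (ω : A.carrier) {i : ℕ} {a : A.carrier} (ha : a ∈ A.grading i)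
    (b : A.carrier) : covD A ω (a * b) = covD A ω a * b + (-1 : k) ^ i • (a * A.d b) := by
  rw [covD_apply, covD_apply, A.leibniz ha, add_mul, mul_assoc]
  abel

lemma CDGAHom.map_covD {A B : CDGA k} (φ : CDGAHom B A) (w b : B.carrier) :
    φ.toFun (covD B w b) = covD A (φ.toFun w) (φ.toFun b) := by
  simp [covD_apply, φ.map_d]

lemma CDGAHom.map_mem_BcOm {A B : CDGA k} (φ : CDGAHom B A) {w b : B.carrier} {i : ℕ}
    (hb : b ∈ BcOm B w i) : φ.toFun b ∈ BcOm A (φ.toFun w) i := by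
  cases i with
  | zero =>
    rw [(Submodule.mem_bot k).1 hb, map_zero]
    exact zero_mem _
  | succ i =>
    obtain ⟨c, hc, rfl⟩ := hb
    exact ⟨φ.toFun c, φ.map_grading hc, (φ.map_covD w c).symm⟩

/-- If every twisted cocycle of `A` is cohomologous to one coming from `B`, the dimension of
the twisted cohomology does not grow. -/
lemma CDGAHom.natCast_le_rank_cohOm {A B : CDGA k} (φ : CDGAHom B A) (w : B.carrier) (i : ℕ)
    (h : ∀ a ∈ ZcOm A (φ.toFun w) i, ∃ b ∈ ZcOm B w i,
      φ.toFun b - a ∈ BcOm A (φ.toFun w) i) {s : ℕ}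
    (hs : (s : Cardinal) ≤ Module.rank k (cohOm A (φ.toFun w) i)) :
    (s : Cardinal) ≤ Module.rank k (cohOm B w i) := by
  have hmap : ∀ b ∈ ZcOm B w i, φ.toFun.toLinearMap b ∈ ZcOm A (φ.toFun w) i := fun b hb =>
    ⟨φ.map_grading hb.1, LinearMap.mem_ker.2 <|
      (φ.map_covD w b).symm.trans (by rw [LinearMap.mem_ker.1 hb.2, map_zero])⟩
  let f : cohOm B w i →ₗ[k] cohOm A (φ.toFun w) i :=
    Submodule.mapQ _ _ (φ.toFun.toLinearMap.restrict hmap) fun b hb => φ.map_mem_BcOm hb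
  refine Cardinal.nat_le_lift_iff.1 <| (Cardinal.nat_le_lift_iff.2 hs).trans <|
    LinearMap.lift_rank_le_of_surjective f fun x => ?_
  obtain ⟨⟨a, ha⟩, rfl⟩ := Submodule.Quotient.mk_surjective _ x
  obtain ⟨b, hb, hab⟩ := h a ha
  exact ⟨Submodule.Quotient.mk ⟨b, hb⟩, (Submodule.Quotient.eq _).2 hab⟩

lemma ZcOm_le_BcOm_of_rank_lt_one (B : CDGA k) (w : B.carrier) (i : ℕ)
    (h : ¬ ((1 : ℕ) : Cardinal) ≤ Module.rank k (cohOm B w i)) : ZcOm B w i ≤ BcOm B w i := by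
  rw [Nat.cast_one, Cardinal.one_le_iff_ne_zero, not_not, rank_zero_iff,
    Submodule.Quotient.subsingleton_iff] at h
  intro b hb
  exact (h ▸ Submodule.mem_top : (⟨b, hb⟩ : ZcOm B w i) ∈
    Submodule.comap (ZcOm B w i).subtype (BcOm B w i))

namespace IsHirsch

variable {B A : CDGA k} {φ : CDGAHom B A} {t : A.carrier} {e : B.carrier}

lemma exists_eq_add_mul
    (H : IsHirsch B A φ (fun _ : Fin 1 => 1) (fun _ => t) (fun _ => e)) (a : A.carrier) :
    ∃ b c, a = φ.toFun b + φ.toFun c * t := by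
  obtain ⟨c, hc, -⟩ := H.free a
  refine ⟨c ∅, c {0}, hc.trans ?_⟩
  have huniv : (Finset.univ : Finset (Finset (Fin 1))) = {∅, {0}} := by decide
  rw [huniv, Finset.sum_pair (by decide)]
  simp [tmono]

lemma eq_zero_of_add_mul_eq_zero_s7
    (H : IsHirsch B A φ (fun _ : Fin 1 => 1) (fun _ => t) (fun _ => e)) {b c : B.carrier}
    (h : φ.toFun b + φ.toFun c * t = 0) : b = 0 ∧ c = 0 := by
  have huniv : (Finset.univ : Finset (Finset (Fin 1))) = {∅, {0}} := by decide
  have hne : ({0} : Finset (Fin 1)) ≠ ∅ := by decide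
  have key := (H.free 0).unique (y₁ := fun S => if S = ∅ then b else c) (y₂ := 0)
    (by
      rw [huniv, Finset.sum_pair hne.symm]
      simp [tmono, h])
    (by simp)
  exact ⟨by simpa using congrFun key ∅, by simpa using congrFun key {0}⟩

lemma mul_t_mem (H : IsHirsch B A φ (fun _ : Fin 1 => 1) (fun _ => t) (fun _ => e))
    (i : ℕ) (c : B.carrier) (hc : c ∈ B.grading i) : φ.toFun c * t ∈ A.grading (i + 1) :=
  A.mul_mem (φ.map_grading hc) (H.t_mem 0)

lemma exists_eq_of_mem_zero
    (H : IsHirsch B A φ (fun _ : Fin 1 => 1) (fun _ => t) (fun _ => e)) {a : A.carrier}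
    (ha : a ∈ A.grading 0) : ∃ b ∈ B.grading 0, a = φ.toFun b := by
  obtain ⟨b, c, rfl⟩ := H.exists_eq_add_mul a
  refine ⟨B.proj 0 b, B.proj_mem 0 b, ?_⟩
  have h₁ := A.proj_map_add B φ.toFun.toLinearMap 0 (fun _ _ hb => φ.map_grading hb) 0 b
  have h₂ := A.proj_map_of_lt B (LinearMap.mulRight k t ∘ₗ φ.toFun.toLinearMap) 1
    H.mul_t_mem one_pos c
  rw [← A.proj_of_mem ha, map_add]
  exact (congrArg₂ (· + ·) h₁ h₂).trans (add_zero _)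

lemma exists_eq_of_mem_succ
    (H : IsHirsch B A φ (fun _ : Fin 1 => 1) (fun _ => t) (fun _ => e)) {a : A.carrier}
    {i : ℕ} (ha : a ∈ A.grading (i + 1)) :
    ∃ b ∈ B.grading (i + 1), ∃ c ∈ B.grading i, a = φ.toFun b + φ.toFun c * t := by
  obtain ⟨b, c, rfl⟩ := H.exists_eq_add_mul a
  refine ⟨B.proj (i + 1) b, B.proj_mem _ b, B.proj i c, B.proj_mem i c, ?_⟩
  have h₁ := A.proj_map_add B φ.toFun.toLinearMap 0 (fun _ _ hb => φ.map_grading hb) (i + 1) b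
  have h₂ := A.proj_map_add B (LinearMap.mulRight k t ∘ₗ φ.toFun.toLinearMap) 1
    H.mul_t_mem i c
  rw [← A.proj_of_mem ha, map_add]
  exact congrArg₂ (· + ·) h₁ h₂

lemma covD_mul_t (H : IsHirsch B A φ (fun _ : Fin 1 => 1) (fun _ => t) (fun _ => e))
    (w : B.carrier) {i : ℕ} {c : B.carrier} (hc : c ∈ B.grading i) :
    covD A (φ.toFun w) (φ.toFun c * t) =
      φ.toFun ((-1 : k) ^ i • (c * e)) + φ.toFun (covD B w c) * t := by
  rw [covD_mul A _ (φ.map_grading hc), H.dt 0, ← φ.map_covD, add_comm, map_smul, map_mul]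

lemma Zc_one_eq (hB : B.Connected)
    (H : IsHirsch B A φ (fun _ : Fin 1 => 1) (fun _ => t) (fun _ => e)) (hne : e ∉ B.Bc 2) :
    A.Zc 1 = (B.Zc 1).map φ.toFun.toLinearMap := by
  refine le_antisymm (fun a ha => ?_) ?_
  · obtain ⟨b, hb, c, hc, rfl⟩ := H.exists_eq_of_mem_succ (i := 0) ha.1
    rw [hB, Submodule.mem_span_singleton] at hc
    obtain ⟨x, rfl⟩ := hc
    have hd : A.d (φ.toFun b + φ.toFun (x • 1) * t) = 0 := ha.2
    have hdb : B.d b + x • e = 0 := H.inj <| by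
      simpa [φ.map_d, H.dt 0] using hd
    have hx : x = 0 := by
      by_contra hx
      refine hne ⟨-x⁻¹ • b, Submodule.smul_mem _ _ hb, ?_⟩
      rw [map_smul, eq_neg_of_add_eq_zero_left hdb, smul_neg, neg_smul, neg_neg, smul_smul,
        inv_mul_cancel₀ hx, one_smul]
    subst hx
    exact ⟨b, ⟨hb, by simpa using hdb⟩, by simp⟩
  · rintro _ ⟨b, hb, rfl⟩
    refine ⟨φ.map_grading hb.1, LinearMap.mem_ker.2 ((φ.map_d b).symm.trans ?_)⟩
    rw [LinearMap.mem_ker.1 hb.2, map_zero]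

lemma exists_cohomologous_zero
    (H : IsHirsch B A φ (fun _ : Fin 1 => 1) (fun _ => t) (fun _ => e)) (w : B.carrier)
    {a : A.carrier} (ha : a ∈ ZcOm A (φ.toFun w) 0) :
    ∃ b ∈ ZcOm B w 0, φ.toFun b - a ∈ BcOm A (φ.toFun w) 0 := by
  obtain ⟨b, hb, rfl⟩ := H.exists_eq_of_mem_zero ha.1
  refine ⟨b, ⟨hb, H.inj ?_⟩, by rw [sub_self]; exact zero_mem _⟩
  rw [φ.map_covD, map_zero]
  exact ha.2

/-- When `H^i(B, d_w)` vanishes, `H^{i+1}(B, d_w) → H^{i+1}(A, d_w)` is surjective. -/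
lemma exists_cohomologous_succ
    (H : IsHirsch B A φ (fun _ : Fin 1 => 1) (fun _ => t) (fun _ => e)) (w : B.carrier)
    {i : ℕ} (hvanish : ZcOm B w i ≤ BcOm B w i) {a : A.carrier}
    (ha : a ∈ ZcOm A (φ.toFun w) (i + 1)) :
    ∃ b ∈ ZcOm B w (i + 1), φ.toFun b - a ∈ BcOm A (φ.toFun w) (i + 1) := by
  obtain ⟨b, hb, c, hc, rfl⟩ := H.exists_eq_of_mem_succ ha.1
  have hd : covD A (φ.toFun w) (φ.toFun b + φ.toFun c * t) = 0 := ha.2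
  rw [map_add, H.covD_mul_t w hc, ← φ.map_covD, ← add_assoc, ← map_add] at hd
  obtain ⟨hdb, hdc⟩ := H.eq_zero_of_add_mul_eq_zero_s7 hd
  have hcB := hvanish ⟨hc, hdc⟩
  have hde : B.d e = 0 := (H.e_cocycle 0).2
  cases i with
  | zero =>
    obtain rfl : c = 0 := (Submodule.mem_bot k).1 hcB
    refine ⟨b, ⟨hb, by simpa using hdb⟩, ?_⟩
    simp
  | succ i =>
    obtain ⟨c', hc', rfl⟩ := hcB
    have hc'e : (-1 : k) ^ i • (c' * e) ∈ B.grading (i + 1 + 1) :=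
      Submodule.smul_mem _ _ (B.mul_mem (i := i) (j := 2) hc' (H.e_cocycle 0).1)
    refine ⟨b - (-1 : k) ^ i • (c' * e), ⟨sub_mem hb hc'e, ?_⟩, -(φ.toFun c' * t),
      neg_mem (H.mul_t_mem i c' hc'), ?_⟩
    · rw [SetLike.mem_coe, LinearMap.mem_ker, map_sub, map_smul, covD_mul B w hc', hde,
        mul_zero, smul_zero, add_zero, ← hdb, pow_succ, mul_neg_one, neg_smul]
      abel
    · rw [map_neg, H.covD_mul_t w hc', map_sub]
      abel

end IsHirsch

end HirschRankOne

section Statement7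

variable {k : Type u} [Field k]

/-- Let `B` be a connected CDGA, `e ∈ Z²(B)` with `[e] ≠ 0` in `H²(B)`, and
let `A = B ⊗_e Λ(t)` be the Hirsch extension with one degree-one generator `t` and `dt = e`.
Then `Z¹(A) = Z¹(B)` (via the canonical inclusion `φ`), and for all `i ≥ 0` and `s ≥ 0` the
rank-one resonance varieties satisfy `ℛ^i_s(A) ⊆ ℛ^{i-1}_1(B) ∪ ℛ^i_s(B)`, as subsets of
`Z¹(B)` (with the convention `ℛ^{-1}_1(B) = ∅`). -/
theorem statement7 (B A : CDGA k) (hBconn : B.Connected)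
    (φ : CDGAHom B A) (t : A.carrier) (e : B.carrier)
    (hhir : IsHirsch B A φ (fun _ : Fin 1 => 1) (fun _ => t) (fun _ => e))
    (hne : e ∉ B.Bc 2) :
    A.Zc 1 = (B.Zc 1).map φ.toFun.toLinearMap ∧
    (∀ s : ℕ, res1 A 0 s ⊆ φ.toFun '' (res1 B 0 s)) ∧
    (∀ i s : ℕ, res1 A (i + 1) s ⊆ φ.toFun '' (res1 B i 1 ∪ res1 B (i + 1) s)) := by
  have hZ := hhir.Zc_one_eq hBconn hne
  refine ⟨hZ, ?_, ?_⟩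
  · rintro s ω ⟨hω, hs⟩
    rw [hZ] at hω
    obtain ⟨w, hw, rfl⟩ := hω
    exact ⟨w, ⟨hw, φ.natCast_le_rank_cohOm w 0
      (fun _ ha => hhir.exists_cohomologous_zero w ha) hs⟩, rfl⟩
  · rintro i s ω ⟨hω, hs⟩
    rw [hZ] at hω
    obtain ⟨w, hw, rfl⟩ := hω
    refine ⟨w, ?_, rfl⟩
    by_cases h : ((1 : ℕ) : Cardinal) ≤ Module.rank k (cohOm B w i)
    · exact Or.inl ⟨hw, h⟩
    · have hvanish := ZcOm_le_BcOm_of_rank_lt_one B w i h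
      exact Or.inr ⟨hw, φ.natCast_le_rank_cohOm w (i + 1)
        (fun _ ha => hhir.exists_cohomologous_succ w hvanish ha) hs⟩

end Statement7
end
end

section
/- Let g ≥ 1, let H = H^•(Σ_g) be the genus-g surface algebra over k with orientation class e, and let A = H ⊗_e Λ(t) be the Hirsch extension with dt = e. Then ℱ(A) = Z¹(A) = H¹(Σ_g), and the rank-one resonance variety satisfies: ℛ¹₁(A) = {0} if g = 1, and ℛ¹₁(A) = H¹(Σ_g) if g > 1. -/
noncomputable section
set_option synthInstance.maxHeartbeats 1000000
set_option maxHeartbeats 1600000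
set_option linter.unusedVariables false

open scoped TensorProduct

universe u v

/-- `H` is the cohomology algebra of a closed orientable surface of genus `g`, with symplectic
basis `a_1, b_1, …, a_g, b_g` in degree 1 and orientation class `e` in degree 2, regarded as a
CDGA with zero differential. -/
structure SurfaceAlg {k : Type u} [Field k] (g : ℕ) (H : CDGA k)
    (a b : Fin g → H.carrier) (e : H.carrier) : Prop where
  d_zero : H.d = 0
  conn : H.Connected
  a_mem : ∀ i, a i ∈ H.grading 1
  b_mem : ∀ i, b i ∈ H.grading 1
  indep : LinearIndependent k (Sum.elim a b)
  span1 : H.grading 1 = Submodule.span k (Set.range (Sum.elim a b))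
  e_ne : e ≠ 0
  span2 : H.grading 2 = Submodule.span k {e}
  top_zero : ∀ i, 2 < i → H.grading i = ⊥
  ab : ∀ i j, a i * b j = if i = j then e else 0
  aa : ∀ i j, a i * a j = 0
  bb : ∀ i j, b i * b j = 0


section GradedShift

variable {R M N : Type*} [Ring R] [AddCommGroup M] [Module R M] [AddCommGroup N] [Module R N]

/-- A linear map raising degrees by `s` commutes with taking homogeneous components. -/
theorem DirectSum.decompose_map_add (ℳ : ℕ → Submodule R M) (𝒩 : ℕ → Submodule R N)
    [DirectSum.Decomposition ℳ] [DirectSum.Decomposition 𝒩] (f : M →ₗ[R] N) (s : ℕ)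
    (hf : ∀ {i x}, x ∈ ℳ i → f x ∈ 𝒩 (i + s)) (x : M) (n : ℕ) :
    (DirectSum.decompose 𝒩 (f x) (n + s) : N) = f (DirectSum.decompose ℳ x n) := by
  induction x using DirectSum.Decomposition.inductionOn ℳ with
  | zero => simp
  | @homogeneous i m =>
    by_cases h : i = n
    · subst h
      rw [DirectSum.decompose_of_mem_same _ (hf m.2), DirectSum.decompose_of_mem_same _ m.2]
    · rw [DirectSum.decompose_of_mem_ne _ (hf m.2) (by omega),
        DirectSum.decompose_of_mem_ne _ m.2 h, map_zero]
  | add x y hx hy => simp [DirectSum.decompose_add, hx, hy]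

/-- The image of a linear map raising degrees by `s` has no components in degrees below `s`. -/
theorem DirectSum.decompose_map_of_lt (ℳ : ℕ → Submodule R M) (𝒩 : ℕ → Submodule R N)
    [DirectSum.Decomposition ℳ] [DirectSum.Decomposition 𝒩] (f : M →ₗ[R] N) (s : ℕ)
    (hf : ∀ {i x}, x ∈ ℳ i → f x ∈ 𝒩 (i + s)) (x : M) {n : ℕ} (hn : n < s) :
    (DirectSum.decompose 𝒩 (f x) n : N) = 0 := by
  induction x using DirectSum.Decomposition.inductionOn ℳ with
  | zero => simp
  | homogeneous m => exact DirectSum.decompose_of_mem_ne _ (hf m.2) (by omega)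
  | add x y hx hy => simp [DirectSum.decompose_add, hx, hy]

end GradedShift

section Hirsch

variable {k : Type u} [Field k] {H A : CDGA k} {φ : CDGAHom H A} {t : A.carrier} {e : H.carrier}

theorem sum_tmono_fin_one (φ : CDGAHom H A) (t : A.carrier) (c : Finset (Fin 1) → H.carrier) :
    ∑ S : Finset (Fin 1), φ.toFun (c S) * tmono A (fun _ => t) S
      = φ.toFun (c ∅) + φ.toFun (c {0}) * t := by
  have h : (Finset.univ : Finset (Finset (Fin 1))) = {∅, {0}} := by decide
  rw [h, Finset.sum_pair (by decide)]
  simp [tmono]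

theorem IsHirsch.exists_eq_add_mul_s10
    (hA : IsHirsch H A φ (fun _ : Fin 1 => 1) (fun _ => t) (fun _ => e)) (z : A.carrier) :
    ∃ x y, z = φ.toFun x + φ.toFun y * t := by
  obtain ⟨c, hc, -⟩ := hA.free z
  exact ⟨_, _, hc.trans (sum_tmono_fin_one φ t c)⟩

theorem IsHirsch.eq_zero_of_add_mul_eq_zero_s10
    (hA : IsHirsch H A φ (fun _ : Fin 1 => 1) (fun _ => t) (fun _ => e)) {x y : H.carrier}
    (h : φ.toFun x + φ.toFun y * t = 0) : x = 0 ∧ y = 0 := by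
  have key := (hA.free 0).unique (y₁ := fun S => if S = ∅ then x else y) (y₂ := fun _ => 0)
    (by simp [sum_tmono_fin_one, h]) (by simp)
  exact ⟨by simpa using congrFun key ∅, by simpa using congrFun key {0}⟩

/-- The degree-one linear map `y ↦ φ y * t`. -/
def mulRightGen (φ : CDGAHom H A) (t : A.carrier) : H.carrier →ₗ[k] A.carrier :=
  (LinearMap.mulRight k t).comp φ.toFun.toLinearMap

theorem mulRightGen_apply (φ : CDGAHom H A) (t : A.carrier) (y : H.carrier) :
    mulRightGen φ t y = φ.toFun y * t := rfl

theorem IsHirsch.mulRightGen_mem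
    (hA : IsHirsch H A φ (fun _ : Fin 1 => 1) (fun _ => t) (fun _ => e)) {i : ℕ} {y : H.carrier}
    (hy : y ∈ H.grading i) : mulRightGen φ t y ∈ A.grading (i + 1) :=
  A.mul_mem (φ.map_grading hy) (hA.t_mem 0)

theorem IsHirsch.exists_of_mem_grading_zero
    (hA : IsHirsch H A φ (fun _ : Fin 1 => 1) (fun _ => t) (fun _ => e)) {z : A.carrier}
    (hz : z ∈ A.grading 0) : ∃ x ∈ H.grading 0, z = φ.toFun x := by
  let := H.decomp
  let := A.decomp
  obtain ⟨x, y, rfl⟩ := hA.exists_eq_add_mul_s10 z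
  refine ⟨DirectSum.decompose H.grading x 0, SetLike.coe_mem _, ?_⟩
  have h := DirectSum.decompose_map_add H.grading A.grading φ.toFun.toLinearMap 0
    (fun h => φ.map_grading h) x 0
  have h' := DirectSum.decompose_map_of_lt H.grading A.grading (mulRightGen φ t) 1
    hA.mulRightGen_mem y zero_lt_one
  rw [← DirectSum.decompose_of_mem_same _ hz, DirectSum.decompose_add, DirectSum.add_apply,
    Submodule.coe_add, ← mulRightGen_apply, h', add_zero]
  exact h

theorem IsHirsch.exists_of_mem_grading_one
    (hA : IsHirsch H A φ (fun _ : Fin 1 => 1) (fun _ => t) (fun _ => e)) {z : A.carrier}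
    (hz : z ∈ A.grading 1) :
    ∃ x ∈ H.grading 1, ∃ y ∈ H.grading 0, z = φ.toFun x + φ.toFun y * t := by
  let := H.decomp
  let := A.decomp
  obtain ⟨x, y, rfl⟩ := hA.exists_eq_add_mul_s10 z
  refine ⟨DirectSum.decompose H.grading x 1, SetLike.coe_mem _,
    DirectSum.decompose H.grading y 0, SetLike.coe_mem _, ?_⟩
  have h := DirectSum.decompose_map_add H.grading A.grading φ.toFun.toLinearMap 0
    (fun h => φ.map_grading h) x 1
  have h' := DirectSum.decompose_map_add H.grading A.grading (mulRightGen φ t) 1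
    hA.mulRightGen_mem y 0
  rw [← DirectSum.decompose_of_mem_same _ hz, DirectSum.decompose_add, DirectSum.add_apply,
    Submodule.coe_add, ← mulRightGen_apply, ← mulRightGen_apply]
  exact congrArg₂ (· + ·) h h'

end Hirsch

section Surface

variable {k : Type u} [Field k] {g : ℕ} {H A : CDGA k} {a b : Fin g → H.carrier} {e : H.carrier}
  {φ : CDGAHom H A} {t : A.carrier}

/-- Every class of degree one on a surface of genus at least two is orthogonal to a class
which is not one of its multiples. -/
theorem SurfaceAlg.exists_mul_eq_zero_notMem_span (hH : SurfaceAlg g H a b e) (hg : 1 < g)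
    {h : H.carrier} (hh : h ∈ H.grading 1) :
    ∃ x ∈ H.grading 1, h * x = 0 ∧ x ∉ Submodule.span k {h} := by
  by_contra! hcon
  have hdim : Module.finrank k (H.grading 1) = 2 * g := by
    rw [hH.span1, finrank_span_eq_card hH.indep]
    simp [two_mul]
  have : FiniteDimensional k (H.grading 1) :=
    FiniteDimensional.of_finrank_pos (by omega)
  let L : H.grading 1 →ₗ[k] H.carrier := (LinearMap.mulLeft k h).comp (H.grading 1).subtype
  have hrange : L.range ≤ Submodule.span k {e} := by
    rintro _ ⟨x, rfl⟩
    rw [← hH.span2]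
    exact H.mul_mem hh x.2
  have hker : L.ker ≤ Submodule.span k {(⟨h, hh⟩ : H.grading 1)} := by
    intro x hx
    obtain ⟨c, hc⟩ := Submodule.mem_span_singleton.1 (hcon x x.2 hx)
    exact Submodule.mem_span_singleton.2 ⟨c, Subtype.ext hc⟩
  have h₁ : Module.finrank k L.range ≤ 1 :=
    (Submodule.finrank_mono hrange).trans ((finrank_span_le_card _).trans_eq (by simp))
  have h₂ : Module.finrank k L.ker ≤ 1 :=
    (Submodule.finrank_mono hker).trans ((finrank_span_le_card _).trans_eq (by simp))
  have h₃ := L.finrank_range_add_finrank_ker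
  omega

/-- In genus one, a class orthogonal to a nonzero class is a multiple of it. -/
theorem SurfaceAlg.mem_span_of_mul_eq_zero {a b : Fin 1 → H.carrier} (hH : SurfaceAlg 1 H a b e)
    {h x : H.carrier} (hh : h ∈ H.grading 1) (hx : x ∈ H.grading 1) (h0 : h ≠ 0)
    (hhx : h * x = 0) : x ∈ Submodule.span k {h} := by
  have hspan : H.grading 1 = Submodule.span k {a 0, b 0} := by
    rw [hH.span1, Set.Sum.elim_range, Set.range_unique, Set.range_unique]
    rfl
  rw [hspan, Submodule.mem_span_pair] at hh hx
  obtain ⟨p, q, rfl⟩ := hh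
  obtain ⟨r, s, rfl⟩ := hx
  have hba : b 0 * a 0 = -e := by
    rw [H.gcomm (hH.b_mem 0) (hH.a_mem 0), hH.ab]
    simp
  have hab : a 0 * b 0 = e := by simp [hH.ab]
  have hprod : (p • a 0 + q • b 0) * (r • a 0 + s • b 0) = (p * s - q * r) • e := by
    simp only [add_mul, mul_add, smul_mul_assoc, mul_smul_comm, hH.aa, hH.bb, hba, hab]
    module
  rw [hprod, smul_eq_zero, or_iff_left hH.e_ne, sub_eq_zero] at hhx
  rw [Submodule.mem_span_singleton]
  by_cases hp : p = 0
  · subst hp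
    have hq : q ≠ 0 := by
      rintro rfl
      simp at h0
    have hr : r = 0 := by simpa [hq] using hhx.symm
    exact ⟨s / q, by simp [smul_smul, hq, hr]⟩
  · refine ⟨r / p, ?_⟩
    rw [smul_add, smul_smul, smul_smul, div_mul_cancel₀ _ hp]
    congr 2
    field_simp
    linear_combination -hhx

theorem SurfaceAlg.exists_of_mem_grading_one (hH : SurfaceAlg g H a b e)
    (hA : IsHirsch H A φ (fun _ : Fin 1 => 1) (fun _ => t) (fun _ => e)) {z : A.carrier}
    (hz : z ∈ A.grading 1) : ∃ x ∈ H.grading 1, ∃ c : k, z = φ.toFun x + c • t := by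
  obtain ⟨x, hx, y, hy, rfl⟩ := hA.exists_of_mem_grading_one hz
  rw [hH.conn, Submodule.mem_span_singleton] at hy
  obtain ⟨c, rfl⟩ := hy
  exact ⟨x, hx, c, by simp⟩

theorem SurfaceAlg.d_map (hH : SurfaceAlg g H a b e) (φ : CDGAHom H A) (x : H.carrier) :
    A.d (φ.toFun x) = 0 := by
  rw [← φ.map_d, hH.d_zero, LinearMap.zero_apply, map_zero]

theorem SurfaceAlg.covD_map_add_smul (hH : SurfaceAlg g H a b e)
    (hA : IsHirsch H A φ (fun _ : Fin 1 => 1) (fun _ => t) (fun _ => e)) (h x : H.carrier)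
    (c : k) :
    covD A (φ.toFun h) (φ.toFun x + c • t)
      = φ.toFun (c • e + h * x) + φ.toFun (c • h) * t := by
  have hdt : A.d t = φ.toFun e := hA.dt 0
  simp only [covD, LinearMap.add_apply, LinearMap.mulLeft_apply, map_add, map_smul, hH.d_map,
    hdt, map_mul, smul_mul_assoc]
  module

/-- The cocycles of degree one in the Hirsch extension are the classes of degree one on the
surface. -/
theorem SurfaceAlg.Zc_one_eq (hH : SurfaceAlg g H a b e)
    (hA : IsHirsch H A φ (fun _ : Fin 1 => 1) (fun _ => t) (fun _ => e)) :
    A.Zc 1 = (H.grading 1).map φ.toFun.toLinearMap := by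
  apply le_antisymm
  · rintro z ⟨hz, hdz⟩
    obtain ⟨x, hx, c, rfl⟩ := hH.exists_of_mem_grading_one hA hz
    have h := hH.covD_map_add_smul hA 0 x c
    have hcov : covD A (φ.toFun 0) (φ.toFun x + c • t) = 0 := by
      simpa [covD] using hdz
    rw [hcov] at h
    have hc := (hA.eq_zero_of_add_mul_eq_zero_s10 h.symm).1
    have hc0 : c = 0 := by simpa [hH.e_ne] using hc
    exact ⟨x, hx, by simp [hc0]⟩
  · rintro _ ⟨x, hx, rfl⟩
    exact ⟨φ.map_grading hx, hH.d_map φ x⟩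

/-- The twisted cocycles of degree one, for the twist by `h`, come from the classes on the
surface orthogonal to `h`. -/
theorem SurfaceAlg.mem_ZcOm_one_iff (hH : SurfaceAlg g H a b e)
    (hA : IsHirsch H A φ (fun _ : Fin 1 => 1) (fun _ => t) (fun _ => e)) {h : H.carrier}
    {z : A.carrier} :
    z ∈ ZcOm A (φ.toFun h) 1 ↔ ∃ x ∈ H.grading 1, h * x = 0 ∧ z = φ.toFun x := by
  constructor
  · rintro ⟨hz, hdz⟩
    obtain ⟨x, hx, c, rfl⟩ := hH.exists_of_mem_grading_one hA hz
    have hdz' := (hH.covD_map_add_smul hA h x c).symm.trans hdz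
    obtain ⟨h₁, h₂⟩ := hA.eq_zero_of_add_mul_eq_zero_s10 hdz'
    have hc : c = 0 := by
      rcases smul_eq_zero.1 h₂ with hc | rfl
      · exact hc
      · simpa [hH.e_ne] using h₁
    exact ⟨x, hx, by simpa [hc] using h₁, by simp [hc]⟩
  · rintro ⟨x, hx, hhx, rfl⟩
    refine ⟨φ.map_grading hx, ?_⟩
    simpa [hhx] using hH.covD_map_add_smul hA h x 0

/-- The twisted coboundaries of degree one, for the twist by `h`, are the multiples of `h`. -/
theorem SurfaceAlg.map_mem_BcOm_one_iff (hH : SurfaceAlg g H a b e)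
    (hA : IsHirsch H A φ (fun _ : Fin 1 => 1) (fun _ => t) (fun _ => e)) {h x : H.carrier} :
    φ.toFun x ∈ BcOm A (φ.toFun h) 1 ↔ x ∈ Submodule.span k {h} := by
  have hcov (c : k) : covD A (φ.toFun h) (φ.toFun (c • 1)) = φ.toFun (c • h) := by
    simpa using hH.covD_map_add_smul hA h (c • 1) 0
  rw [Submodule.mem_span_singleton]
  constructor
  · rintro ⟨z, hz, hzx⟩
    obtain ⟨y, hy, rfl⟩ := hA.exists_of_mem_grading_zero hz
    rw [hH.conn, Submodule.mem_span_singleton] at hy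
    obtain ⟨c, rfl⟩ := hy
    exact ⟨c, hA.inj ((hcov c).symm.trans hzx)⟩
  · rintro ⟨c, rfl⟩
    exact ⟨_, φ.map_grading ((H.grading 0).smul_mem c H.one_mem), hcov c⟩

theorem one_le_rank_cohOm_iff (A : CDGA k) (ω : A.carrier) (i : ℕ) :
    ((1 : ℕ) : Cardinal) ≤ Module.rank k (cohOm A ω i) ↔
      ∃ z ∈ ZcOm A ω i, z ∉ BcOm A ω i := by
  rw [Nat.cast_one, Cardinal.one_le_iff_ne_zero, Ne, rank_zero_iff,
    Submodule.Quotient.subsingleton_iff, Submodule.comap_subtype_eq_top,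
    SetLike.not_le_iff_exists]

/-- The first resonance variety consists of the classes `h` which are orthogonal to some class
outside the span of `h`. -/
theorem SurfaceAlg.mem_res1_iff (hH : SurfaceAlg g H a b e)
    (hA : IsHirsch H A φ (fun _ : Fin 1 => 1) (fun _ => t) (fun _ => e)) {ω : A.carrier} :
    ω ∈ res1 A 1 1 ↔ ∃ h ∈ H.grading 1, φ.toFun h = ω ∧
      ∃ x ∈ H.grading 1, h * x = 0 ∧ x ∉ Submodule.span k {h} := by
  rw [res1, Set.mem_ofPred_eq, one_le_rank_cohOm_iff, hH.Zc_one_eq hA]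
  constructor
  · rintro ⟨⟨h, hh, rfl⟩, z, hz, hzB⟩
    obtain ⟨x, hx, hhx, rfl⟩ := (hH.mem_ZcOm_one_iff hA).1 hz
    exact ⟨h, hh, rfl, x, hx, hhx, fun hmem => hzB ((hH.map_mem_BcOm_one_iff hA).2 hmem)⟩
  · rintro ⟨h, hh, rfl, x, hx, hhx, hspan⟩
    exact ⟨⟨h, hh, rfl⟩, φ.toFun x, (hH.mem_ZcOm_one_iff hA).2 ⟨x, hx, hhx, rfl⟩,
      fun hmem => hspan ((hH.map_mem_BcOm_one_iff hA).1 hmem)⟩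

end Surface

section Statement10

variable {k : Type u} [Field k]

/-- Let `g ≥ 1`, let `H = H^•(Σ_g)` be the genus-`g` surface algebra over `k`
with orientation class `e`, and let `A = H ⊗_e Λ(t)` be the Hirsch extension with `dt = e`.
Then `ℱ(A) = Z¹(A) = H¹(Σ_g)` (via the canonical inclusion `φ`), and the rank-one resonance
variety satisfies `ℛ¹₁(A) = {0}` if `g = 1`, and `ℛ¹₁(A) = H¹(Σ_g)` if `g > 1`. -/
theorem statement10 (g : ℕ) (hg : 1 ≤ g) (H A : CDGA k)
    (a b : Fin g → H.carrier) (e : H.carrier) (hH : SurfaceAlg g H a b e)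
    (φ : CDGAHom H A) (t : A.carrier)
    (hhir : IsHirsch H A φ (fun _ : Fin 1 => 1) (fun _ => t) (fun _ => e)) :
    A.Zc 1 = (H.grading 1).map φ.toFun.toLinearMap ∧
    (g = 1 → res1 A 1 1 = {0}) ∧
    (1 < g → res1 A 1 1 = φ.toFun '' (H.grading 1 : Set H.carrier)) := by
  refine ⟨hH.Zc_one_eq hhir, ?_, fun hg' => ?_⟩
  · rintro rfl
    ext ω
    rw [hH.mem_res1_iff hhir, Set.mem_singleton_iff]
    constructor
    · rintro ⟨h, hh, rfl, x, hx, hhx, hspan⟩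
      by_contra h0
      exact hspan (hH.mem_span_of_mul_eq_zero hh hx (fun h' => h0 (by simp [h'])) hhx)
    · rintro rfl
      refine ⟨0, zero_mem _, map_zero _, a 0, hH.a_mem 0, zero_mul _, ?_⟩
      simpa using hH.indep.ne_zero (Sum.inl 0)
  · ext ω
    rw [hH.mem_res1_iff hhir]
    constructor
    · rintro ⟨h, hh, rfl, -⟩
      exact ⟨h, hh, rfl⟩
    · rintro ⟨h, hh, rfl⟩
      exact ⟨h, hh, rfl, hH.exists_mul_eq_zero_notMem_span hg' hh⟩

end Statement10
end
end
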